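/- arXiv:1805.02563 — 5 statements merged into one kernel-verified Lean document; each statement's English description precedes it below -/
import Mathlib

section
/- Suppose k ≥ 2 and n ≥ k+2. Then for every 1 ≤ ℓ ≤ k+1, the kernel of Θ_1 : H^*⊗L_n(k+1) → C_n(k) is contained in the kernel of Θ_ℓ : H^*⊗L_n(k+1) → C_n(ℓ−1)⊗C_n(k−ℓ+1). -/
open scoped TensorProduct

namespace JC

/-- Words of length `m` in the letters `0,…,N-1`: index words for a basis of `H^{⊗m}`. -/
abbrev Word (N m : ℕ) := Fin m → Fin N

/-- The `m`-th tensor power `H^{⊗m}` of `H = R^N`, realized as the free module on words. -/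
abbrev TP (R : Type) [CommRing R] (N m : ℕ) := Word N m → R

section
variable {R : Type} [CommRing R] {N : ℕ}

/-- The basis element of `H^{⊗m}` corresponding to a word. -/
def eb {m : ℕ} (w : Word N m) : TP R N m := fun u => if u = w then 1 else 0

/-- Prepend the basis vector `e_i` (or the dual basis vector `e_i^*`) to a tensor. -/
def pre {m : ℕ} (i : Fin N) (x : TP R N m) : TP R N (m+1) :=
  fun w => if w 0 = i then x (Fin.tail w) else 0

/-- `[x, e_j] = x ⊗ e_j - e_j ⊗ x` inside the tensor algebra. -/
def brkt {m : ℕ} (x : TP R N (m+1)) (j : Fin N) : TP R N (m+2) :=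
  fun w =>
    (if w (Fin.last (m+1)) = j then x (Fin.init w) else 0)
      - (if w 0 = j then x (Fin.tail w) else 0)

/-- The left-normed bracket `[e_{c 0}, e_{c 1}, …, e_{c (m-1)}] ∈ L_N(m) ⊆ H^{⊗m}`. -/
def lnb : (m : ℕ) → Word N m → TP R N m
  | 0, _ => 0
  | 1, c => eb c
  | m+2, c => brkt (lnb (m+1) (Fin.init c)) (c (Fin.last (m+1)))

/-- The left-normed bracket `[y, e_{c 0}, …, e_{c (m-1)}]` starting from an arbitrary `y ∈ H`. -/
def lnbY : (m : ℕ) → TP R N 1 → Word N m → TP R N (m+1)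
  | 0, y, _ => y
  | m+1, y, c => brkt (lnbY m y (Fin.init c)) (c (Fin.last m))

end

/-- The degree-`m` homogeneous component of the free Lie ring on `H`, inside `H^{⊗m}`
(spanned by the left-normed brackets of basis vectors). -/
def LieComp (R : Type) [CommRing R] (N m : ℕ) : Submodule R (TP R N m) :=
  Submodule.span R (Set.range (lnb (R := R) (N := N) m))

/-- `H^* ⊗ L_N(k+1)` inside `H^* ⊗ H^{⊗(k+1)} = H^{⊗(k+2)}` (the first letter of a word
records the index of a dual basis vector `e_i^*`). -/
def DLie (R : Type) [CommRing R] (N k : ℕ) : Submodule R (TP R N (k+2)) :=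
  Submodule.span R
    { x | ∃ (i : Fin N) (c : Word N (k+1)), x = pre i (lnb (k+1) c) }

section
variable {R : Type} [CommRing R] {N : ℕ}

/-- The contraction `Φ_{1,ℓ+2} : H^* ⊗ H^{⊗(k+1)} → H^{⊗k}` (with 0-based `ℓ`; this is the
paper's `Φ_{1,ℓ+1}` for 1-based `ℓ`): `f ⊗ a_1 ⊗ ⋯ ⊗ a_{k+1} ↦ f(a_{ℓ+1})·a_1 ⊗ ⋯ (omit) ⋯ ⊗ a_{k+1}`. -/
def Phi (k : ℕ) (ℓ : Fin (k+1)) (x : TP R N (k+2)) : TP R N k :=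
  fun u => ∑ i : Fin N, x (Fin.cons i (Fin.insertNth ℓ i u))

end

/-- The submodule of cyclic-permutation relations in `H^{⊗m}`. -/
def cycRel (R : Type) [CommRing R] (N m : ℕ) : Submodule R (TP R N m) :=
  Submodule.span R { x | ∃ w : Word N m, x = eb w - eb (w ∘ finRotate m) }

/-- `C_N(m)`: the quotient of `H^{⊗m}` by the cyclic permutation action. -/
abbrev Cyc (R : Type) [CommRing R] (N m : ℕ) := TP R N m ⧸ cycRel R N m

/-- The projection `π_m : H^{⊗m} → C_N(m)`. -/
def piC (R : Type) [CommRing R] (N m : ℕ) : TP R N m →ₗ[R] Cyc R N m :=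
  (cycRel R N m).mkQ

section
variable {R : Type} [CommRing R] {N : ℕ}

/-- The first `ℓ` letters of a word of length `k`. -/
def splitF {k : ℕ} (ℓ : Fin (k+1)) (u : Word N k) : Word N (ℓ:ℕ) :=
  fun t => u ⟨(t:ℕ), by have h1 := t.isLt; have h2 := ℓ.isLt; omega⟩

/-- The last `k-ℓ` letters of a word of length `k`. -/
def splitB {k : ℕ} (ℓ : Fin (k+1)) (u : Word N k) : Word N (k - (ℓ:ℕ)) :=
  fun t => u ⟨(ℓ:ℕ) + (t:ℕ), by have h1 := t.isLt; omega⟩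

end

/-- `Θ_{ℓ+1} = ϖ_{ℓ+1} ∘ Φ_{1,ℓ+2} : H^* ⊗ L_N(k+1) → C_N(ℓ) ⊗ C_N(k-ℓ)` (0-based `ℓ`,
so this is the paper's `Θ_ℓ` for 1-based `ℓ ∈ {1,…,k+1}`). -/
noncomputable def Theta (R : Type) [CommRing R] (N k : ℕ) (ℓ : Fin (k+1))
    (x : TP R N (k+2)) : (Cyc R N (ℓ:ℕ)) ⊗[R] (Cyc R N (k - (ℓ:ℕ))) :=
  ∑ u : Word N k,
    (Phi k ℓ x u) •
      ((piC R N (ℓ:ℕ)) (eb (splitF ℓ u)) ⊗ₜ[R] (piC R N (k - (ℓ:ℕ))) (eb (splitB ℓ u)))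

section
variable {N : ℕ}

/-- The word realizing `e_{←S} ⊗ e_{→S^c}`: the letters of `c` at the positions of `S` in
decreasing order of position, followed by the letters at the positions of the complement of
`S` in increasing order of position. -/
def swWord {k : ℕ} (c : Word N k) (s : Finset (Fin k)) : Word N k := fun j =>
  if h : (j:ℕ) < s.card then
    c ((s.orderIsoOfFin rfl) ⟨s.card - 1 - (j:ℕ), by omega⟩).1
  else
    c ((sᶜ.orderIsoOfFin rfl) ⟨(j:ℕ) - s.card, by
      have h1 : sᶜ.card = k - s.card := by simp [Finset.card_compl]
      have h2 := j.isLt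
      omega⟩).1

end

section
variable {R : Type} [CommRing R] {N : ℕ}

/-- Insert the vector `y ∈ H` at position `p` of a degree-`k` tensor. -/
def insT {k : ℕ} (p : Fin (k+1)) (y : TP R N 1) (x : TP R N k) : TP R N (k+1) :=
  fun w => y (fun _ => w p) * x (p.removeNth w)

end

/-- Generators of type `K_1`. -/
def K1set (R : Type) [CommRing R] (N k : ℕ) : Set (TP R N (k+2)) :=
  { x | ∃ (i : Fin N) (d : Word N (k+1)), (∀ t, d t ≠ i) ∧ x = pre i (lnb (k+1) d) }

/-- Generators of type `K_2`. -/
def K2set (R : Type) [CommRing R] (N k : ℕ) : Set (TP R N (k+2)) :=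
  { x | ∃ (i : Fin N) (c : Word N k), (∀ t, c t ≠ i) ∧
      x = pre i (lnb (k+1) (Fin.snoc c i)) }

/-- Generators of type `K_3`. -/
def K3set (R : Type) [CommRing R] (N k : ℕ) : Set (TP R N (k+2)) :=
  { x | ∃ (i j : Fin N) (c : Word N k), (∀ t, c t ≠ i) ∧ (∀ t, c t ≠ j) ∧
      x = pre i (lnb (k+1) (Fin.cons i c))
        - pre j (lnb (k+1) (Fin.cons j (c ∘ (finRotate k).symm))) }

/-- Generators of type `K_4`. -/
def K4set (R : Type) [CommRing R] (N k : ℕ) : Set (TP R N (k+2)) :=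
  { x | ∃ (i m' : Fin N) (d : Word N (k+1)), (∃ j, d j = i) ∧ (∀ t, d t ≠ m') ∧
      x = pre i (lnb (k+1) d)
        - ∑ j : Fin (k+1),
            (if d j = i then (1:R) else 0) • pre m' (lnb (k+1) (Function.update d j m')) }

end JC

namespace JC

section Shuffle
variable {α R M : Type*}

/-- The sum of `f` over all shuffles of the words `u` and `v`. -/
def shuffleSum [Add R] (f : List α → R) : List α → List α → R
  | [], v => f v
  | a :: u, [] => f (a :: u)
  | a :: u, b :: v =>
      shuffleSum (fun w => f (a :: w)) u (b :: v) + shuffleSum (fun w => f (b :: w)) (a :: u) v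
termination_by u v => u.length + v.length

/-- The sum of `T p q` over all ways to split `w` into a subword `p` of length `a` and its
complementary subword `q`. -/
def unshuffleSum [AddCommMonoid M] : ℕ → (List α → List α → M) → List α → M
  | 0, T, w => T [] w
  | _ + 1, _, [] => 0
  | a + 1, T, x :: w =>
      unshuffleSum a (fun p q => T (x :: p) q) w + unshuffleSum (a + 1) (fun p q => T p (x :: q)) w

/-- The bracket `[f, e_j]` on coefficient functions of noncommutative polynomials. -/
def listBrkt [DecidableEq α] [AddGroup R] (f : List α → R) (j : α) (w : List α) : R :=
  (if w.getLast? = some j then f w.dropLast else 0) - (if w.head? = some j then f w.tail else 0)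

/-- The identity `(P, u x v) = (-1)^|u| (P, x (rev u ⧢ v))` satisfied by the coefficients of every
Lie polynomial `P`. -/
def ShuffleIdentity [Ring R] (f : List α → R) : Prop :=
  ∀ u x v, f (u ++ x :: v) = (-1) ^ u.length * shuffleSum (fun w => f (x :: w)) u.reverse v

@[simp] lemma shuffleSum_nil_left [Add R] (f : List α → R) (v : List α) :
    shuffleSum f [] v = f v := by
  rw [shuffleSum]

@[simp] lemma shuffleSum_nil_right [Add R] (f : List α → R) (u : List α) :
    shuffleSum f u [] = f u := by
  cases u <;> rw [shuffleSum]

lemma shuffleSum_cons_cons [Add R] (f : List α → R) (a b : α) (u v : List α) :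
    shuffleSum f (a :: u) (b :: v) =
      shuffleSum (fun w => f (a :: w)) u (b :: v) +
        shuffleSum (fun w => f (b :: w)) (a :: u) v := by
  rw [shuffleSum]

lemma shuffleSum_append_append [AddCommMonoid R] (f : List α → R) (a b : α) (u v : List α) :
    shuffleSum f (u ++ [a]) (v ++ [b]) =
      shuffleSum (fun w => f (w ++ [a])) u (v ++ [b]) +
        shuffleSum (fun w => f (w ++ [b])) (u ++ [a]) v := by
  induction u generalizing f v with
  | nil =>
    induction v generalizing f with
    | nil => simp [shuffleSum_cons_cons, add_comm]
    | cons y v ih =>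
      have := ih (fun w => f (y :: w))
      simp only [List.nil_append, shuffleSum_nil_left, List.cons_append] at this ⊢
      rw [shuffleSum_cons_cons, shuffleSum_cons_cons, this]
      simp only [shuffleSum_nil_left, List.cons_append]
      abel
  | cons x u ihu =>
    induction v generalizing f with
    | nil =>
      have := ihu (fun w => f (x :: w)) []
      simp only [List.nil_append, shuffleSum_nil_right, List.cons_append] at this ⊢
      rw [shuffleSum_cons_cons, shuffleSum_cons_cons, this]
      simp only [shuffleSum_nil_right, List.cons_append]
      abel
    | cons y v ihv =>
      have h1 := ihu (fun w => f (x :: w)) (y :: v)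
      have h2 := ihv (fun w => f (y :: w))
      simp only [List.cons_append] at h1 h2 ⊢
      rw [shuffleSum_cons_cons, shuffleSum_cons_cons, shuffleSum_cons_cons, h1, h2]
      simp only [List.cons_append]
      abel

lemma shuffleSum_sub [AddCommGroup R] (f g : List α → R) (u v : List α) :
    shuffleSum (fun w => f w - g w) u v = shuffleSum f u v - shuffleSum g u v := by
  induction u generalizing f g v with
  | nil => simp
  | cons x u ihu =>
    induction v generalizing f g with
    | nil => simp
    | cons y v ihv => simp only [shuffleSum_cons_cons, ihu, ihv]; abel

lemma shuffleSum_eq_zero [AddCommMonoid R] (f : List α → R) (u v : List α)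
    (h : ∀ w, w.length = u.length + v.length → f w = 0) : shuffleSum f u v = 0 := by
  induction u generalizing f v with
  | nil => simpa using h v (by simp)
  | cons x u ihu =>
    induction v generalizing f with
    | nil => simpa using h (x :: u) (by simp)
    | cons y v ihv =>
      rw [shuffleSum_cons_cons, ihu, ihv, add_zero]
      · intro w hw; exact h _ (by simp only [List.length_cons] at hw ⊢; omega)
      · intro w hw; exact h _ (by simp only [List.length_cons] at hw ⊢; omega)

lemma shuffleSum_zero [AddCommMonoid R] (u v : List α) :
    shuffleSum (fun _ => (0 : R)) u v = 0 :=
  shuffleSum_eq_zero _ _ _ fun _ _ => rfl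

lemma shuffleSum_ite [AddCommMonoid R] (p : Prop) [Decidable p] (f : List α → R)
    (u v : List α) :
    shuffleSum (fun w => if p then f w else 0) u v = if p then shuffleSum f u v else 0 := by
  split_ifs <;> simp [shuffleSum_zero]

namespace ShuffleIdentity

lemma shuffleSum_eq_zero [Ring R] {f : List α → R} (hf : ShuffleIdentity f) (a b : α)
    (u v : List α) : shuffleSum f (a :: u) (b :: v) = 0 := by
  have h1 := hf u.reverse a (b :: v)
  have h2 := hf (u.reverse ++ [a]) b v
  simp only [List.append_assoc, List.singleton_append, List.length_append, List.reverse_append,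
    List.reverse_reverse, List.length_reverse, List.length_singleton, List.reverse_singleton,
    pow_succ] at h1 h2
  rw [h1] at h2
  have h3 : (-1 : R) ^ u.length * shuffleSum f (a :: u) (b :: v) = 0 := by
    rw [shuffleSum_cons_cons, mul_add, h2]
    simp
  rcases neg_one_pow_eq_or R u.length with h | h <;> simpa [h] using h3

lemma reverse [Ring R] {f : List α → R} (hf : ShuffleIdentity f) (u : List α) (x : α) :
    f (u ++ [x]) = (-1) ^ u.length * f (x :: u.reverse) := by
  simpa using hf u x []

lemma listBrkt [DecidableEq α] [CommRing R] {f : List α → R} (hf : ShuffleIdentity f) (j : α) :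
    ShuffleIdentity (listBrkt f j) := by
  intro u x v
  rcases u with _ | ⟨a, u⟩
  · simp
  rcases List.eq_nil_or_concat' v with rfl | ⟨v, b, rfl⟩
  · simp only [JC.listBrkt, shuffleSum_nil_right, List.reverse_cons, ← List.cons_append,
      List.getLast?_concat, List.dropLast_concat]
    simp only [List.cons_append, List.head?_cons, List.tail_cons, List.length_cons,
      Option.some.injEq]
    have h1 := hf.reverse u x
    have h2 : f (a :: u) = (-1) ^ u.length * f (u.reverse ++ [a]) := by
      have := hf.reverse u.reverse a
      rw [this]
      simp [← mul_assoc, ← mul_pow]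
    rw [h1, h2]
    split_ifs <;> ring
  · have hz : shuffleSum f (u.reverse ++ [a]) (v ++ [b]) = 0 := by
      obtain ⟨c, s, hs⟩ := List.exists_cons_of_ne_nil (l := u.reverse ++ [a]) (by simp)
      obtain ⟨d, t, ht⟩ := List.exists_cons_of_ne_nil (l := v ++ [b]) (by simp)
      rw [hs, ht, hf.shuffleSum_eq_zero]
    have h1 := hf (a :: u) x v
    have h2 := hf u x (v ++ [b])
    have e : a :: u ++ x :: (v ++ [b]) = (a :: u ++ x :: v) ++ [b] := by simp
    simp only [JC.listBrkt, shuffleSum_sub]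
    simp only [e, List.getLast?_concat, List.dropLast_concat, Option.some.injEq,
      List.head?_cons, List.tail_cons, shuffleSum_ite, List.reverse_cons, hz, h1]
    rw [shuffleSum_append_append]
    simp only [← List.cons_append, List.getLast?_concat, List.dropLast_concat, Option.some.injEq,
      shuffleSum_ite]
    simp only [List.cons_append, List.head?_cons, List.tail_cons, List.append_assoc,
      Option.some.injEq, h2, List.length_cons]
    split_ifs <;> ring

lemma single [DecidableEq α] [CommRing R] (c : α) :
    ShuffleIdentity (fun w => if w = [c] then (1 : R) else 0) := by
  intro u x v
  by_cases h : u = [] ∧ v = []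
  · obtain ⟨rfl, rfl⟩ := h
    simp
  · have hl : 0 < u.length + v.length := by
      rcases u with _ | _ <;> rcases v with _ | _ <;> simp_all
    rw [JC.shuffleSum_eq_zero, mul_zero]
    · refine if_neg fun e => ?_
      have := congrArg List.length e
      simp only [List.length_append, List.length_cons, List.length_nil] at this
      omega
    · intro w hw
      refine if_neg fun e => ?_
      have := congrArg List.length e
      simp only [List.length_cons, List.length_nil, List.length_reverse] at this hw
      omega

end ShuffleIdentity

lemma unshuffleSum_append [AddCommMonoid M] (a : ℕ) (T : List α → List α → M) (w : List α)
    (x : α) :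
    unshuffleSum (a + 1) T (w ++ [x]) =
      unshuffleSum a (fun p q => T (p ++ [x]) q) w +
        unshuffleSum (a + 1) (fun p q => T p (q ++ [x])) w := by
  induction w generalizing a T with
  | nil => cases a <;> simp [unshuffleSum]
  | cons y w ih =>
    cases a with
    | zero => simp [unshuffleSum, ih]; abel
    | succ a => simp only [List.cons_append, unshuffleSum, ih]; abel

lemma unshuffleSum_rotate [AddCommMonoid M] (a : ℕ) (T : List α → List α → M)
    (hl : ∀ x p q, T (x :: p) q = T (p ++ [x]) q) (hr : ∀ x p q, T p (x :: q) = T p (q ++ [x]))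
    (x : α) (w : List α) : unshuffleSum a T (w ++ [x]) = unshuffleSum a T (x :: w) := by
  cases a with
  | zero => simp [unshuffleSum, hr]
  | succ a => simp only [unshuffleSum_append, unshuffleSum, hl, hr]

lemma unshuffleSum_eq_zero_of_length_lt [AddCommMonoid M] (a : ℕ) (T : List α → List α → M)
    (w : List α) (h : w.length < a) : unshuffleSum a T w = 0 := by
  induction w generalizing a T with
  | nil => cases a <;> simp_all [unshuffleSum]
  | cons x w ih =>
    cases a with
    | zero => simp at h
    | succ a =>
      simp only [List.length_cons] at h
      rw [unshuffleSum, ih _ _ (by omega), ih _ _ (by omega), add_zero]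

lemma unshuffleSum_length [AddCommMonoid M] (T : List α → List α → M) (w : List α) :
    unshuffleSum w.length T w = T w [] := by
  induction w generalizing T with
  | nil => simp [unshuffleSum]
  | cons x w ih =>
    rw [List.length_cons, unshuffleSum, ih, unshuffleSum_eq_zero_of_length_lt _ _ _ (by simp),
      add_zero]

/-- The sum of `f` over all words of length `k`. -/
def wordSum [Fintype α] [AddCommMonoid M] : ℕ → (List α → M) → M
  | 0, f => f []
  | k + 1, f => ∑ i, wordSum k (fun w => f (i :: w))

variable [Fintype α]

lemma wordSum_congr [AddCommMonoid M] (k : ℕ) {f g : List α → M}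
    (h : ∀ w, w.length = k → f w = g w) : wordSum k f = wordSum k g := by
  induction k generalizing f g with
  | zero => exact h _ rfl
  | succ k ih => exact Finset.sum_congr rfl fun i _ => ih fun w hw => h _ (by simp [hw])

lemma wordSum_eq_sum [AddCommMonoid M] (k : ℕ) (f : List α → M) :
    wordSum k f = ∑ u : Fin k → α, f (List.ofFn u) := by
  induction k generalizing f with
  | zero => simp [wordSum]
  | succ k ih =>
    rw [← (Fin.consEquiv fun _ : Fin (k + 1) => α).sum_comp, Fintype.sum_prod_type]
    simp [wordSum, ih, Fin.consEquiv, List.ofFn_succ]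

lemma wordSum_add [AddCommMonoid M] (k : ℕ) (f g : List α → M) :
    wordSum k (fun w => f w + g w) = wordSum k f + wordSum k g := by
  simp only [wordSum_eq_sum, Finset.sum_add_distrib]

lemma wordSum_sum [AddCommMonoid M] {ι : Type*} (s : Finset ι) (k : ℕ) (f : ι → List α → M) :
    wordSum k (fun w => ∑ i ∈ s, f i w) = ∑ i ∈ s, wordSum k (f i) := by
  simp only [wordSum_eq_sum]
  exact Finset.sum_comm

lemma wordSum_succ_append [AddCommMonoid M] (k : ℕ) (f : List α → M) :
    wordSum (k + 1) f = wordSum k (fun w => ∑ i, f (w ++ [i])) := by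
  induction k generalizing f with
  | zero => simp [wordSum]
  | succ k ih => exact Finset.sum_congr rfl fun i _ => ih fun w => f (i :: w)

lemma wordSum_reverse [AddCommMonoid M] (k : ℕ) (f : List α → M) :
    wordSum k (fun w => f w.reverse) = wordSum k f := by
  induction k generalizing f with
  | zero => simp [wordSum]
  | succ k ih =>
    rw [wordSum_succ_append, wordSum_sum]
    simp only [List.reverse_append, List.reverse_singleton, List.singleton_append]
    exact Finset.sum_congr rfl fun i _ => ih fun w => f (i :: w)

lemma wordSum_take_drop [AddCommMonoid M] (a b : ℕ) (h : List α → List α → M) :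
    wordSum (a + b) (fun w => h (w.take a) (w.drop a)) =
      wordSum a (fun p => wordSum b (fun q => h p q)) := by
  induction a generalizing h with
  | zero => simp [wordSum]
  | succ a ih =>
    rw [Nat.add_right_comm]
    simp only [wordSum, List.take_succ_cons, List.drop_succ_cons]
    exact Finset.sum_congr rfl fun i _ => ih fun p q => h (i :: p) q

/-- Shuffling and unshuffling are adjoint to each other. -/
lemma wordSum_shuffleSum_smul [Ring R] [AddCommGroup M] [Module R M] (a b : ℕ)
    (f : List α → R) (T : List α → List α → M) :
    wordSum a (fun p => wordSum b (fun q => shuffleSum f p q • T p q)) =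
      wordSum (a + b) (fun w => f w • unshuffleSum a T w) := by
  induction a generalizing b f T with
  | zero => simp [wordSum, unshuffleSum]
  | succ a iha =>
    induction b generalizing f T with
    | zero =>
      refine wordSum_congr _ fun w hw => ?_
      rw [← hw, unshuffleSum_length]
      simp [wordSum]
    | succ b ihb =>
      have h1 := fun i => iha (b + 1) (fun w => f (i :: w)) (fun p q => T (i :: p) q)
      have h2 := fun i => ihb (fun w => f (i :: w)) (fun p q => T p (i :: q))
      rw [show a + 1 + (b + 1) = (a + 1 + b) + 1 by omega]
      have h3 : wordSum (a + 1 + b + 1) (fun w => f w • unshuffleSum (a + 1) T w) =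
          ∑ i, wordSum (a + 1 + b) (fun w => f (i :: w) •
            (unshuffleSum a (fun p q => T (i :: p) q) w +
              unshuffleSum (a + 1) (fun p q => T p (i :: q)) w)) := rfl
      rw [h3]
      simp only [smul_add, wordSum_add, Finset.sum_add_distrib]
      simp only [show a + (b + 1) = a + 1 + b by omega] at h1
      simp only [← h1, ← h2]
      simp only [wordSum, wordSum_sum, shuffleSum_cons_cons, add_smul, wordSum_add,
        Finset.sum_add_distrib]
      congr 1
      exact Finset.sum_comm

end Shuffle

section
variable {R : Type} [CommRing R] {N : ℕ}

lemma exists_shuffleIdentity_lnb (m : ℕ) (c : Word N (m + 1)) :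
    ∃ f : List (Fin N) → R, ShuffleIdentity f ∧ ∀ u, lnb (m + 1) c u = f (List.ofFn u) := by
  induction m with
  | zero =>
    refine ⟨_, ShuffleIdentity.single (c 0), fun u => ?_⟩
    simp [lnb, eb, funext_iff]
  | succ m ih =>
    obtain ⟨f, hf, h⟩ := ih (Fin.init c)
    refine ⟨_, hf.listBrkt (c (Fin.last (m + 1))), fun u => ?_⟩
    have e : (List.ofFn u) = List.ofFn (Fin.init u) ++ [u (Fin.last (m + 1))] :=
      (List.ofFn_succ' u).trans (List.concat_eq_append ..)
    have h1 : (List.ofFn u).getLast? = some (u (Fin.last (m + 1))) := by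
      rw [e, List.getLast?_concat]
    have h2 : (List.ofFn u).dropLast = List.ofFn (Fin.init u) := by 
      rw [e, List.dropLast_concat]
    have h3 : (List.ofFn u).head? = some (u 0) := by simp [List.ofFn_succ]
    have h4 : (List.ofFn u).tail = List.ofFn (Fin.tail u) := by
      rw [List.ofFn_succ]; rfl
    simp only [listBrkt, h1, h2, h3, h4, Option.some.injEq]
    simp only [lnb, brkt, h]

/-- The class in `C_N(m)` of a word given as a list (zero unless it has length `m`). -/
def cycWord (R : Type) [CommRing R] (N m : ℕ) (l : List (Fin N)) : Cyc R N m :=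
  piC R N m (fun u => if List.ofFn u = l then 1 else 0)

lemma cycWord_ofFn (m : ℕ) (w : Word N m) : cycWord R N m (List.ofFn w) = piC R N m (eb w) := by
  simp only [cycWord, List.ofFn_inj]
  rfl

lemma cycWord_of_length_ne {m : ℕ} {l : List (Fin N)} (h : l.length ≠ m) :
    cycWord R N m l = 0 := by
  have : (fun u : Word N m => if List.ofFn u = l then (1 : R) else 0) = 0 := by
    funext u
    refine if_neg fun e => h ?_
    simp [← e]
  rw [cycWord, this, map_zero]

lemma ofFn_comp_finRotate {α : Type*} (m : ℕ) (w : Fin (m + 1) → α) :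
    List.ofFn (w ∘ finRotate (m + 1)) = List.ofFn (Fin.tail w) ++ [w 0] := by
  rw [List.ofFn_succ', List.concat_eq_append]
  simp [Fin.tail_def]

lemma cycWord_rotate (m : ℕ) (x : Fin N) (l : List (Fin N)) :
    cycWord R N m (x :: l) = cycWord R N m (l ++ [x]) := by
  by_cases h : l.length + 1 = m
  · subst h
    have e1 : x :: l = List.ofFn (Fin.cons x l.get : Word N (l.length + 1)) := by
      simp [List.ofFn_succ]
    have e2 : l ++ [x] =
        List.ofFn ((Fin.cons x l.get : Word N (l.length + 1)) ∘ finRotate (l.length + 1)) := by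
      rw [ofFn_comp_finRotate]; simp
    rw [e2, e1, cycWord_ofFn, cycWord_ofFn, ← sub_eq_zero, ← map_sub]
    exact (Submodule.Quotient.mk_eq_zero _).2 (Submodule.subset_span ⟨_, rfl⟩)
  · rw [cycWord_of_length_ne (by simpa using h), cycWord_of_length_ne (by simpa using h)]

/-- The tensor `π_a(rev p) ⊗ π_b(q)`. -/
noncomputable def cycTensor (R : Type) [CommRing R] (N a b : ℕ) (p q : List (Fin N)) :
    Cyc R N a ⊗[R] Cyc R N b :=
  cycWord R N a p.reverse ⊗ₜ[R] cycWord R N b q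

lemma sum_smul_eq_zero_of_mem_cycRel {M : Type*} [AddCommGroup M] [Module R M] {k : ℕ}
    {G : Word N k → M} (hG : ∀ w, G (w ∘ finRotate k) = G w) {g : TP R N k}
    (hg : g ∈ cycRel R N k) : ∑ w, g w • G w = 0 := by
  induction hg using Submodule.span_induction with
  | mem g hg =>
    obtain ⟨w, rfl⟩ := hg
    simp [eb, sub_smul, Finset.sum_sub_distrib, hG]
  | zero => simp
  | add x y _ _ hx hy => simp [add_smul, Finset.sum_add_distrib, hx, hy]
  | smul r x _ hx => simp [mul_smul, ← Finset.smul_sum, hx]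

lemma unshuffleSum_cycTensor_finRotate {k : ℕ} (a b : ℕ) (w : Word N k) :
    unshuffleSum a (cycTensor R N a b) (List.ofFn (w ∘ finRotate k)) =
      unshuffleSum a (cycTensor R N a b) (List.ofFn w) := by
  cases k with
  | zero => simp
  | succ k =>
    rw [ofFn_comp_finRotate, unshuffleSum_rotate, List.ofFn_succ (f := w)]
    · rfl
    · intro x p q; simp [cycTensor, cycWord_rotate]
    · intro x p q; simp [cycTensor, cycWord_rotate]

lemma ofFn_splitF {k : ℕ} (ℓ : Fin (k + 1)) (u : Word N k) :
    List.ofFn (splitF ℓ u) = (List.ofFn u).take ℓ := by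
  have := ℓ.isLt
  apply List.ext_getElem
  · simp; omega
  · intro i h1 h2; simp [splitF]

lemma ofFn_splitB {k : ℕ} (ℓ : Fin (k + 1)) (u : Word N k) :
    List.ofFn (splitB ℓ u) = (List.ofFn u).drop ℓ := by
  apply List.ext_getElem
  · simp
  · intro i h1 h2; simp [splitB]

lemma ofFn_insertNth {α : Type*} {k : ℕ} (ℓ : Fin (k + 1)) (i : α) (u : Fin k → α) :
    List.ofFn (Fin.insertNth ℓ i u : Fin (k + 1) → α) =
      (List.ofFn u).take ℓ ++ i :: (List.ofFn u).drop ℓ := by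
  obtain ⟨w, rfl, rfl⟩ : ∃ w : Fin (k + 1) → α, w ℓ = i ∧ Fin.removeNth ℓ w = u :=
    ⟨Fin.insertNth ℓ i u, by simp, by simp⟩
  have := ℓ.isLt
  rw [Fin.insertNth_self_removeNth]
  apply List.ext_getElem
  · simp; omega
  · intro j h1 h2
    simp only [List.length_ofFn] at h1
    simp only [List.getElem_ofFn, List.getElem_append, List.length_take, List.length_ofFn,
      List.getElem_take, List.getElem_cons, List.getElem_drop, Fin.removeNth_apply,
      Fin.succAbove, Fin.lt_def, Fin.val_castSucc]
    split_ifs <;> first | omega | rfl | (congr 1; ext; simp; omega)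

lemma Phi_pre (k : ℕ) (ℓ : Fin (k + 1)) (i : Fin N) (x : TP R N (k + 1)) (u : Word N k) :
    Phi k ℓ (pre i x) u = x (Fin.insertNth ℓ i u) := by
  simp [Phi, pre]

lemma Phi_add (k : ℕ) (ℓ : Fin (k + 1)) (x y : TP R N (k + 2)) (u : Word N k) :
    Phi k ℓ (x + y) u = Phi k ℓ x u + Phi k ℓ y u := by
  simp [Phi, Finset.sum_add_distrib]

lemma Phi_smul (k : ℕ) (ℓ : Fin (k + 1)) (r : R) (x : TP R N (k + 2)) (u : Word N k) :
    Phi k ℓ (r • x) u = r * Phi k ℓ x u := by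
  simp [Phi, Finset.mul_sum]

/-- On `H^* ⊗ L_N(k+1)` the map `Θ_{ℓ+1}` factors through `Φ_{1,2}`. -/
lemma Theta_eq_sum_unshuffleSum (k : ℕ) (ℓ : Fin (k + 1)) {x : TP R N (k + 2)}
    (hx : x ∈ DLie R N k) :
    Theta R N k ℓ x = (-1 : R) ^ (ℓ : ℕ) • ∑ w, Phi k 0 x w •
      unshuffleSum ℓ (cycTensor R N ℓ (k - ℓ)) (List.ofFn w) := by
  induction hx using Submodule.span_induction with
  | mem x hx =>
    obtain ⟨i, c, rfl⟩ := hx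
    obtain ⟨f, hf, hc⟩ := exists_shuffleIdentity_lnb (R := R) k c
    have hk : (ℓ : ℕ) + (k - ℓ) = k := by have := ℓ.isLt; omega
    simp only [Theta, Phi_pre, hc, ofFn_insertNth, ← cycWord_ofFn, ofFn_splitF, ofFn_splitB]
    simp only [Fin.val_zero, List.take_zero, List.drop_zero, List.nil_append]
    rw [← wordSum_eq_sum k fun w => f (w.take ℓ ++ i :: w.drop ℓ) •
        (cycWord R N ℓ (w.take ℓ) ⊗ₜ[R] cycWord R N (k - ℓ) (w.drop ℓ)),
      ← wordSum_eq_sum k fun w => f (i :: w) •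
        unshuffleSum ℓ (cycTensor R N ℓ (k - ℓ)) w]
    have h1 := wordSum_take_drop (ℓ : ℕ) (k - ℓ) fun p q => f (p ++ i :: q) •
        (cycWord R N ℓ p ⊗ₜ[R] cycWord R N (k - ℓ) q)
    have h2 := wordSum_shuffleSum_smul (ℓ : ℕ) (k - ℓ) (fun w => f (i :: w))
      (cycTensor R N ℓ (k - ℓ))
    rw [hk] at h1 h2
    rw [h1, ← h2, ← wordSum_reverse]
    simp only [wordSum_eq_sum, Finset.smul_sum]
    refine Finset.sum_congr rfl fun p _ => Finset.sum_congr rfl fun q _ => ?_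
    rw [hf]
    simp [cycTensor, mul_smul]
  | zero => simp [Theta, Phi]
  | add x y _ _ hx hy =>
    have : Theta R N k ℓ (x + y) = Theta R N k ℓ x + Theta R N k ℓ y := by
      simp [Theta, Phi_add, add_smul, Finset.sum_add_distrib]
    simp [this, hx, hy, Phi_add, add_smul, Finset.sum_add_distrib]
  | smul r x _ hx =>
    have : Theta R N k ℓ (r • x) = r • Theta R N k ℓ x := by
      simp [Theta, Phi_smul, mul_smul, Finset.smul_sum]
    simp only [this, hx, Phi_smul, mul_smul, ← Finset.smul_sum]
    rw [smul_comm]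

end

end JC

open JC in
/-- Theorem tC: for `k ≥ 2` and `n ≥ k+2`, the kernel of
`Θ_1 = π_k ∘ Φ_{1,2} : H^* ⊗ L_n(k+1) → C_n(k)` is contained in the kernel of
`Θ_ℓ : H^* ⊗ L_n(k+1) → C_n(ℓ-1) ⊗ C_n(k-ℓ+1)` for every `1 ≤ ℓ ≤ k+1`
(here `ℓ : Fin (k+1)` is the 0-based version of the paper's `ℓ`). -/
theorem ker_Theta1_subset_ker_Theta (n k : ℕ) (hk : 2 ≤ k) (hn : k + 2 ≤ n)
    (x : TP ℤ n (k+2)) (hx : x ∈ DLie ℤ n k)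
    (hker : piC ℤ n k (Phi k 0 x) = 0) :
    ∀ ℓ : Fin (k+1), Theta ℤ n k ℓ x = 0 := by
  intro ℓ
  rw [Theta_eq_sum_unshuffleSum k ℓ hx,
    sum_smul_eq_zero_of_mem_cycRel (unshuffleSum_cycTensor_finRotate _ _)
      ((Submodule.Quotient.mk_eq_zero _).1 hker), smul_zero]
end

section
/- Suppose k ≥ 2 and n ≥ k+2. Then the kernel of π_k∘Φ_{1,2} : H^*⊗L_n(k+1) → C_n(k) (which equals the image of the k-th Johnson homomorphism τ'_k of Aut(F_n)) is generated as a ℤ-module by the following elements: (K1) e_i^*⊗[e_{i_1},e_{i_2},…,e_{i_{k+1}}] for all indices with i_1,…,i_{k+1} ≠ i; (K2) e_i^*⊗[e_{i_1},e_{i_2},…,e_{i_k},e_i] for all indices with i_1,…,i_k ≠ i; (K3) e_i^*⊗[e_i,e_{i_1},…,e_{i_k}] − e_j^*⊗[e_j,e_{i_k},e_{i_1},…,e_{i_{k−1}}] for all indices with i,j ∉ {i_1,…,i_k} (possibly i = j); (K4) e_i^*⊗[e_{i_1},…,e_{i_{k+1}}] − Σ_{j=1}^{k+1} δ_{i,i_j}·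 e_m^*⊗[e_{i_1},…,e_{i_{j−1}},e_m,e_{i_{j+1}},…,e_{i_{k+1}}] for all indices with i = i_j for some j and m ∉ {i_1,…,i_{k+1}}. -/
open scoped TensorProduct

namespace JC

section Tensor
variable {R : Type} [CommRing R] {N : ℕ}

/-- Prepending a basis vector, as a linear map. -/
def preL (R : Type) [CommRing R] {N : ℕ} (m : ℕ) (i : Fin N) : TP R N m →ₗ[R] TP R N (m + 1) where
  toFun := pre i
  map_add' x y := by ext w; simp only [pre, Pi.add_apply]; split_ifs <;> simp
  map_smul' a x := by ext w; simp [pre]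

/-- Bracketing with a basis vector, as a linear map. -/
def brktL (R : Type) [CommRing R] {N : ℕ} (m : ℕ) (j : Fin N) :
    TP R N (m + 1) →ₗ[R] TP R N (m + 2) where
  toFun x := brkt x j
  map_add' x y := by ext w; simp only [brkt, Pi.add_apply]; split_ifs <;> ring
  map_smul' a x := by
    ext w; simp only [brkt, Pi.smul_apply, smul_eq_mul, RingHom.id_apply]; split_ifs <;> ring

/-- Contraction of the first letter with the dual basis vector `e_i^*`. -/
def ctr (R : Type) [CommRing R] {N : ℕ} (m : ℕ) (i : Fin N) : TP R N (m + 1) →ₗ[R] TP R N m where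
  toFun x u := x (Fin.cons i u)
  map_add' _ _ := rfl
  map_smul' _ _ := rfl

/-- Right multiplication by a basis vector. -/
def rmul (R : Type) [CommRing R] {N : ℕ} (m : ℕ) (j : Fin N) : TP R N m →ₗ[R] TP R N (m + 1) where
  toFun x u := if u (Fin.last m) = j then x (Fin.init u) else 0
  map_add' x y := by ext w; simp only [Pi.add_apply]; split_ifs <;> simp
  map_smul' a x := by ext w; simp

/-- The contraction `Phi k 0`, as a linear map. -/
def PhiL (R : Type) [CommRing R] (N k : ℕ) : TP R N (k + 2) →ₗ[R] TP R N k where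
  toFun := Phi k 0
  map_add' x y := by ext w; simp [Phi, Finset.sum_add_distrib]
  map_smul' a x := by ext w; simp [Phi, Finset.mul_sum]

theorem PhiL_pre {k : ℕ} (i : Fin N) (x : TP R N (k + 1)) :
    PhiL R N k (pre i x) = ctr R k i x := by
  ext u
  simp [PhiL, Phi, pre, ctr]

theorem ctr_brkt {m : ℕ} (i j : Fin N) (x : TP R N (m + 1)) :
    ctr R (m + 1) i (brkt x j) = rmul R m j (ctr R m i x) - if i = j then x else 0 := by
  ext u
  have h1 : (Fin.cons i u : Word N (m + 2)) (Fin.last (m + 1)) = u (Fin.last m) := by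
    rw [← Fin.succ_last, Fin.cons_succ]
  have h2 : Fin.init (Fin.cons i u : Word N (m + 2)) = Fin.cons i (Fin.init u) := by
    conv_lhs => rw [← Fin.snoc_init_self u]
    rw [Fin.cons_snoc_eq_snoc_cons, Fin.init_snoc]
  simp only [ctr, brkt, rmul, LinearMap.coe_mk, AddHom.coe_mk, Pi.sub_apply, h1, h2,
    Fin.cons_zero, Fin.tail_cons]
  split_ifs <;> rfl

theorem eb_eq_single {m : ℕ} (w : Word N m) : (eb w : TP R N m) = Pi.single w 1 := by
  ext u
  simp [eb, Pi.single_apply]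

theorem rmul_eb {m : ℕ} (w : Word N m) (j : Fin N) :
    rmul R m j (eb w) = eb (Fin.snoc w j) := by
  ext u
  have : u = Fin.snoc w j ↔ u (Fin.last m) = j ∧ Fin.init u = w := by
    constructor
    · rintro rfl
      simp
    · rintro ⟨rfl, rfl⟩
      simp
  by_cases h1 : u (Fin.last m) = j <;> by_cases h2 : Fin.init u = w <;>
    simp [rmul, eb, this, h1, h2]

theorem pre_eb {m : ℕ} (w : Word N m) (j : Fin N) :
    pre j (eb w : TP R N m) = eb (Fin.cons j w) := by
  ext u
  have : u = Fin.cons j w ↔ u 0 = j ∧ Fin.tail u = w := by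
    constructor
    · rintro rfl
      simp
    · rintro ⟨rfl, rfl⟩
      simp
  by_cases h1 : u 0 = j <;> by_cases h2 : Fin.tail u = w <;> simp [pre, eb, this, h1, h2]

theorem brkt_eb {m : ℕ} (w : Word N (m + 1)) (j : Fin N) :
    brkt (eb w : TP R N (m + 1)) j = eb (Fin.snoc w j) - eb (Fin.cons j w) := by
  rw [← rmul_eb, ← pre_eb]
  rfl

theorem lnb_snoc {m : ℕ} (c : Word N (m + 1)) (a : Fin N) :
    (lnb (m + 2) (Fin.snoc c a) : TP R N (m + 2)) = brkt (lnb (m + 1) c) a := by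
  simp [lnb]

/-- Linear maps out of `TP R N m` are determined by their values on words. -/
theorem TP_hom_ext {M : Type*} [AddCommGroup M] [Module R M] {m : ℕ}
    {f g : TP R N m →ₗ[R] M} (h : ∀ w, f (eb w) = g (eb w)) : f = g := by
  refine LinearMap.pi_ext' fun w => LinearMap.ext_ring ?_
  simpa [eb_eq_single] using h w

theorem piC_brkt {m : ℕ} (x : TP R N (m + 1)) (j : Fin N) :
    piC R N (m + 2) (brkt x j) = 0 := by
  have : piC R N (m + 2) ∘ₗ brktL R m j = 0 := by
    refine TP_hom_ext fun w => ?_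
    change piC R N (m + 2) (brkt (eb w) j) = 0
    rw [brkt_eb, ← neg_sub, map_neg, neg_eq_zero, piC, Submodule.mkQ_apply,
      Submodule.Quotient.mk_eq_zero]
    refine Submodule.subset_span ⟨Fin.cons j w, ?_⟩
    rw [Fin.snoc_eq_cons_rotate]
    rfl
  exact LinearMap.congr_fun this x

theorem ctr_lnb_of_forall_ne {m : ℕ} (i : Fin N) (d : Word N (m + 1)) (hd : ∀ t, d t ≠ i) :
    ctr R m i (lnb (m + 1) d) = 0 := by
  induction m with
  | zero =>
    ext u
    have : (Fin.cons i u : Word N 1) ≠ d := fun h => hd 0 (by rw [← h]; rfl)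
    simp [ctr, lnb, eb, this]
  | succ m ih =>
    induction d using Fin.snocCases with
    | snoc d a =>
      have h1 : i ≠ a := fun h => hd (Fin.last _) (by simp [h])
      rw [lnb_snoc, ctr_brkt, ih d fun t => by simpa using hd t.castSucc]
      simp [h1]

theorem ctr_lnb_cons {m : ℕ} (i : Fin N) (c : Word N m) (hc : ∀ t, c t ≠ i) :
    ctr R m i (lnb (m + 1) (Fin.cons i c)) = eb c := by
  induction m with
  | zero =>
    ext u
    obtain rfl : u = c := Subsingleton.elim _ _
    simp [ctr, lnb, eb]
  | succ m ih =>
    induction c using Fin.snocCases with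
    | snoc c a =>
      have h1 : i ≠ a := fun h => hc (Fin.last _) (by simp [h])
      rw [Fin.cons_snoc_eq_snoc_cons, lnb_snoc, ctr_brkt,
        ih c fun t => by simpa using hc t.castSucc, rmul_eb]
      simp [h1]

theorem ctr_lnb_eq_sum {m : ℕ} (i a : Fin N) (d : Word N (m + 1)) (hd : ∀ t, d t ≠ a) :
    ctr R m i (lnb (m + 1) d) = ∑ j, (if d j = i then (1 : R) else 0) •
      ctr R m a (lnb (m + 1) (Function.update d j a)) := by
  induction m with
  | zero =>
    ext u
    have h1 : (Fin.cons i u : Word N 1) = d ↔ d 0 = i := by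
      rw [funext_iff, Fin.forall_fin_one]
      exact eq_comm
    have h2 : (Fin.cons a u : Word N 1) = Function.update d 0 a := by
      rw [funext_iff, Fin.forall_fin_one]
      simp
    by_cases h : d 0 = i <;> simp [ctr, lnb, eb, h1, h2, h]
  | succ m ih =>
    induction d using Fin.snocCases with
    | snoc d b =>
      have h0 : a ≠ b := fun h => hd (Fin.last _) (by simp [h])
      have h1 : ∀ t, d t ≠ a := fun t => by simpa using hd t.castSucc
      rw [Fin.sum_univ_castSucc]
      simp only [Fin.snoc_castSucc, Fin.snoc_last, Fin.update_snoc_last, ← Fin.snoc_update,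
        lnb_snoc, ctr_brkt, ctr_lnb_of_forall_ne a d h1, ih d h1, h0, if_true, if_false, sub_zero,
        map_zero, zero_sub, map_sum, map_smul]
      by_cases h : i = b
      · subst h
        simp [sub_eq_add_neg]
      · simp [h, Ne.symm h]

end Tensor

section FreeAlgebra
variable (R : Type) [CommRing R] {N : ℕ}

/-- The monomial of a list of letters in the free associative algebra. -/
noncomputable def mon (l : List (Fin N)) : MonoidAlgebra R (FreeMonoid (Fin N)) :=
  MonoidAlgebra.of R (FreeMonoid (Fin N)) (FreeMonoid.ofList l)

theorem mon_append (l l' : List (Fin N)) : mon R (l ++ l') = mon R l * mon R l' := by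
  simp only [mon, FreeMonoid.ofList_append, map_mul]

/-- The embedding of a tensor power in the free associative algebra. -/
noncomputable def toFree (N m : ℕ) : TP R N m →ₗ[R] MonoidAlgebra R (FreeMonoid (Fin N)) :=
  Fintype.linearCombination R fun w : Word N m => mon R (List.ofFn w)

theorem toFree_eb {m : ℕ} (w : Word N m) : toFree R N m (eb w) = mon R (List.ofFn w) := by
  rw [eb_eq_single, toFree, Fintype.linearCombination_apply_single, one_smul]

theorem toFree_injective (m : ℕ) : Function.Injective (toFree R N m) := by
  have h := (MonoidAlgebra.basis (FreeMonoid (Fin N)) R).linearIndependent.comp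
    (fun w : Word N m => FreeMonoid.ofList (List.ofFn w))
    (FreeMonoid.ofList.injective.comp List.ofFn_injective)
  rw [linearIndependent_iff_injective_fintypeLinearCombination] at h
  convert h using 2
  refine congrArg _ (funext fun w => ?_)
  rw [Function.comp_apply, MonoidAlgebra.basis_apply, mon, MonoidAlgebra.of_apply]

theorem ofFn_snoc {α : Type*} {m : ℕ} (w : Fin m → α) (a : α) :
    List.ofFn (Fin.snoc w a : Fin (m + 1) → α) = List.ofFn w ++ [a] := by
  rw [List.ofFn_succ_last, Fin.snoc_last]
  simp

theorem exists_ofFn_eq {α : Type*} {m : ℕ} {l : List α} (h : l.length = m) :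
    ∃ c : Fin m → α, List.ofFn c = l := by
  subst h
  exact ⟨l.get, List.ofFn_get l⟩

theorem toFree_brkt {m : ℕ} (x : TP R N (m + 1)) (j : Fin N) :
    toFree R N (m + 2) (brkt x j) = ⁅toFree R N (m + 1) x, mon R [j]⁆ := by
  have : toFree R N (m + 2) ∘ₗ brktL R m j =
      (LinearMap.mulRight R (mon R [j]) - LinearMap.mulLeft R (mon R [j])) ∘ₗ
        toFree R N (m + 1) := by
    refine TP_hom_ext fun w => ?_
    change toFree R N (m + 2) (brkt (eb w) j) = _
    simp only [brkt_eb, map_sub, toFree_eb, LinearMap.comp_apply, LinearMap.sub_apply,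
      LinearMap.mulRight_apply, LinearMap.mulLeft_apply, ← mon_append]
    congr 2
    · rw [ofFn_snoc]
    · rw [List.ofFn_cons, List.singleton_append]
  rw [Ring.lie_def]
  exact LinearMap.congr_fun this x

/-- The iterated bracket `[X, e_{l_0}, e_{l_1}, …]` in the free associative algebra. -/
noncomputable def lieFold (X : MonoidAlgebra R (FreeMonoid (Fin N))) (l : List (Fin N)) :
    MonoidAlgebra R (FreeMonoid (Fin N)) :=
  l.foldl (fun Y a => ⁅Y, mon R [a]⁆) X

theorem lieFold_append_singleton (X : MonoidAlgebra R (FreeMonoid (Fin N)))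
    (l : List (Fin N)) (a : Fin N) :
    lieFold R X (l ++ [a]) = ⁅lieFold R X l, mon R [a]⁆ := by
  simp [lieFold]

theorem toFree_lnb {m : ℕ} (a : Fin N) (c : Word N m) :
    toFree R N (m + 1) (lnb (m + 1) (Fin.cons a c)) = lieFold R (mon R [a]) (List.ofFn c) := by
  induction m with
  | zero => simp [lnb, toFree_eb, lieFold]
  | succ m ih =>
    induction c using Fin.snocCases with
    | snoc c b =>
      rw [Fin.cons_snoc_eq_snoc_cons, lnb_snoc, toFree_brkt, ih, ← lieFold_append_singleton,
        ofFn_snoc]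

theorem lie_mem_span_lieFold (b : Fin N) (l : List (Fin N))
    (X : MonoidAlgebra R (FreeMonoid (Fin N))) :
    ⁅X, lieFold R (mon R [b]) l⁆ ∈
      Submodule.span R { Y | ∃ l', l'.Perm (b :: l) ∧ Y = lieFold R X l' } := by
  induction l using List.reverseRecOn generalizing X with
  | nil => exact Submodule.subset_span ⟨[b], .refl _, rfl⟩
  | append_singleton l a ih =>
    have key : ⁅X, lieFold R (mon R [b]) (l ++ [a])⁆ =
        ⁅⁅X, lieFold R (mon R [b]) l⁆, mon R [a]⁆ -
          ⁅⁅X, mon R [a]⁆, lieFold R (mon R [b]) l⁆ := by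
      rw [lieFold_append_singleton]
      simp only [Ring.lie_def]
      noncomm_ring
    rw [key]
    refine Submodule.sub_mem _ ?_ (Submodule.span_mono ?_ (ih ⁅X, mon R [a]⁆))
    · have h := ih X
      generalize ⁅X, lieFold R (mon R [b]) l⁆ = Z at h
      induction h using Submodule.span_induction with
      | mem Y hY =>
        obtain ⟨l', hl, rfl⟩ := hY
        exact Submodule.subset_span
          ⟨l' ++ [a], hl.append_right [a], (lieFold_append_singleton R X l' a).symm⟩
      | zero => rw [Ring.lie_def, zero_mul, mul_zero, sub_zero]; exact Submodule.zero_mem _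
      | add Y Z _ _ hY hZ => 
        have h : ⁅Y + Z, mon R [a]⁆ = ⁅Y, mon R [a]⁆ + ⁅Z, mon R [a]⁆ := by
          simp only [Ring.lie_def]
          noncomm_ring
        exact h ▸ Submodule.add_mem _ hY hZ
      | smul r Y _ hY =>
        rw [Ring.lie_def, smul_mul_assoc, mul_smul_comm, ← smul_sub, ← Ring.lie_def]
        exact Submodule.smul_mem _ r hY
    · rintro Y ⟨l', hl, rfl⟩
      refine ⟨a :: l', ?_, rfl⟩
      exact (hl.cons a).trans (List.perm_append_singleton a (b :: l)).symm

variable {R}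

/-- A bracket `[y, e_a]`, with `y` a Lie monomial free of `e_a`, is a combination of
left-normed brackets starting with `e_a`. -/
theorem brkt_lnb_mem_span {m : ℕ} (a : Fin N) (d : Word N (m + 1)) (hd : ∀ t, d t ≠ a) :
    (brkt (lnb (m + 1) d) a : TP R N (m + 2)) ∈ Submodule.span R
      { x | ∃ c : Word N (m + 1), (∀ t, c t ≠ a) ∧ x = lnb (m + 2) (Fin.cons a c) } := by
  have h : toFree R N (m + 2) (brkt (lnb (m + 1) d) a) ∈ (Submodule.span R
      { x | ∃ c : Word N (m + 1), (∀ t, c t ≠ a) ∧ x = lnb (m + 2) (Fin.cons a c) }).map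
        (toFree R N (m + 2)) := by
    rw [Submodule.map_span, toFree_brkt, Ring.lie_def, ← neg_sub, ← Ring.lie_def]
    refine Submodule.neg_mem _ ?_
    conv in lnb (m + 1) d => rw [← Fin.cons_self_tail d]
    rw [toFree_lnb]
    refine Submodule.span_mono ?_ (lie_mem_span_lieFold R (d 0) (List.ofFn (Fin.tail d)) _)
    rintro Y ⟨l, hl, rfl⟩
    have hl' : l.Perm (List.ofFn d) := by rwa [List.ofFn_succ]
    have hlen : l.length = m + 1 := by simpa using hl'.length_eq
    obtain ⟨c, rfl⟩ := exists_ofFn_eq hlen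
    refine ⟨_, ⟨c, fun t => ?_, rfl⟩, toFree_lnb R a c⟩
    obtain ⟨s, hs⟩ := List.mem_ofFn.mp (hl'.mem_iff.mp (List.mem_ofFn.mpr ⟨t, rfl⟩))
    exact hs ▸ hd s
  obtain ⟨y, hy, hxy⟩ := h
  rwa [← toFree_injective R (m + 2) hxy]

theorem lnb_mem_span_of_unique {m : ℕ} (a : Fin N) (d : Word N (m + 1)) (j : Fin (m + 1))
    (hj : d j = a) (hd : ∀ t, t ≠ j → d t ≠ a) :
    (lnb (m + 1) d : TP R N (m + 1)) ∈ Submodule.span R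
      { x | ∃ c : Word N m, (∀ t, c t ≠ a) ∧ x = lnb (m + 1) (Fin.cons a c) } := by
  induction m with
  | zero =>
    refine Submodule.subset_span ⟨Fin.elim0, fun t => t.elim0, ?_⟩
    congr 1
    rw [Fin.fin_one_eq_zero j] at hj
    rw [funext_iff, Fin.forall_fin_one, hj, Fin.cons_zero]
  | succ m ih =>
    induction d using Fin.snocCases with
    | snoc d b =>
      rw [lnb_snoc]
      induction j using Fin.lastCases with
      | last =>
        obtain rfl : b = a := by simpa using hj
        exact brkt_lnb_mem_span b d fun t => by
          simpa using hd t.castSucc (Fin.castSucc_lt_last t).ne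
      | cast j =>
        have hb : b ≠ a := by simpa using hd (Fin.last _) (Fin.castSucc_lt_last j).ne'
        have h := ih d j (by simpa using hj) fun t ht => by
          simpa using hd t.castSucc fun h => ht (Fin.castSucc_injective _ h)
        have h' := Submodule.mem_map_of_mem (f := brktL R m b) h
        rw [Submodule.map_span] at h'
        refine Submodule.span_mono ?_ h'
        rintro _ ⟨_, ⟨c, hc, rfl⟩, rfl⟩
        refine ⟨Fin.snoc c b, fun t => ?_, ?_⟩
        · induction t using Fin.lastCases with
          | last => simpa using hb
          | cast t => simpa using hc t
        · rw [Fin.cons_snoc_eq_snoc_cons, lnb_snoc]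
          rfl

end FreeAlgebra

theorem exists_forall_ne {n m : ℕ} (h : m < n) (d : Word n m) : ∃ a, ∀ t, d t ≠ a := by
  by_contra! hc
  have := Fintype.card_le_of_surjective d hc
  simp at this
  omega

section Kernel
variable {R : Type} [CommRing R] {n k : ℕ}

/-- The span of the generators of types `K_1`, `K_2`, `K_3`, `K_4`. -/
def Kspan (R : Type) [CommRing R] (n k : ℕ) : Submodule R (TP R n (k + 2)) :=
  Submodule.span R (K1set R n k ∪ K2set R n k ∪ K3set R n k ∪ K4set R n k)

theorem pre_lnb_mem_DLie (i : Fin n) (c : Word n (k + 1)) :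
    pre i (lnb (k + 1) c) ∈ DLie R n k :=
  Submodule.subset_span ⟨i, c, rfl⟩

theorem Kspan_le_DLie : Kspan R n k ≤ DLie R n k := by
  refine Submodule.span_le.mpr ?_
  rintro _ (((⟨i, d, -, rfl⟩ | ⟨i, c, -, rfl⟩) | ⟨i, j, c, -, -, rfl⟩) | ⟨i, a, d, -, -, rfl⟩)
  · exact pre_lnb_mem_DLie _ _
  · exact pre_lnb_mem_DLie _ _
  · exact Submodule.sub_mem _ (pre_lnb_mem_DLie _ _) (pre_lnb_mem_DLie _ _)
  · exact Submodule.sub_mem _ (pre_lnb_mem_DLie _ _)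
      (Submodule.sum_mem _ fun j _ => Submodule.smul_mem _ _ (pre_lnb_mem_DLie _ _))

theorem piC_eb_comp_rotate (c : Word n k) :
    piC R n k (eb (c ∘ (finRotate k).symm)) = piC R n k (eb c) := by
  rw [piC, Submodule.mkQ_apply, Submodule.mkQ_apply, Submodule.Quotient.eq]
  refine Submodule.subset_span ⟨c ∘ (finRotate k).symm, ?_⟩
  rw [Function.comp_assoc, Equiv.symm_comp_self, Function.comp_id]

theorem Kspan_le_ker (hk : 2 ≤ k) : Kspan R n k ≤ (piC R n k ∘ₗ PhiL R n k).ker := by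
  refine Submodule.span_le.mpr ?_
  rintro _ (((⟨i, d, hd, rfl⟩ | ⟨i, c, hc, rfl⟩) | ⟨i, j, c, hi, hj, rfl⟩) |
    ⟨i, a, d, -, hd, rfl⟩) <;>
    rw [SetLike.mem_coe, LinearMap.mem_ker, LinearMap.comp_apply]
  · rw [PhiL_pre, ctr_lnb_of_forall_ne i d hd, map_zero]
  · obtain ⟨k, rfl⟩ := Nat.exists_eq_add_of_le' hk
    rw [PhiL_pre, lnb_snoc, ctr_brkt, ctr_lnb_of_forall_ne i c hc, map_zero, if_pos rfl, zero_sub,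
      map_neg, lnb, piC_brkt, neg_zero]
  · rw [map_sub, PhiL_pre, PhiL_pre, ctr_lnb_cons i c hi,
      ctr_lnb_cons j (c ∘ _) fun t => hj _, map_sub, piC_eb_comp_rotate, sub_self]
  · simp only [map_sub, map_sum, map_smul, PhiL_pre]
    rw [ctr_lnb_eq_sum i a d hd]
    simp only [map_sum, map_smul, sub_self]

/-- A linear section of the contraction `PhiL R n k`. -/
noncomputable def sec (R : Type) [CommRing R] {n k : ℕ} (hn : k < n) :
    TP R n k →ₗ[R] TP R n (k + 2) :=
  Fintype.linearCombination R fun c : Word n k =>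
    pre (exists_forall_ne hn c).choose (lnb (k + 1) (Fin.cons (exists_forall_ne hn c).choose c))

theorem sec_eb (hn : k < n) (c : Word n k) : sec R hn (eb c) =
    pre (exists_forall_ne hn c).choose
      (lnb (k + 1) (Fin.cons (exists_forall_ne hn c).choose c)) := by
  rw [eb_eq_single, sec, Fintype.linearCombination_apply_single, one_smul]

theorem PhiL_sec (hn : k < n) (y : TP R n k) : PhiL R n k (sec R hn y) = y := by
  have : PhiL R n k ∘ₗ sec R hn = LinearMap.id := by
    refine TP_hom_ext fun c => ?_
    rw [LinearMap.comp_apply, sec_eb, PhiL_pre,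
      ctr_lnb_cons _ _ (exists_forall_ne hn c).choose_spec]
    rfl
  exact LinearMap.congr_fun this y

theorem pre_lnb_cons_sub_mem (i j : Fin n) (c : Word n k) (hi : ∀ t, c t ≠ i)
    (hj : ∀ t, c t ≠ j) :
    pre i (lnb (k + 1) (Fin.cons i c)) -
      pre j (lnb (k + 1) (Fin.cons j (c ∘ (finRotate k).symm))) ∈ Kspan R n k :=
  Submodule.subset_span (.inl (.inr ⟨i, j, c, hi, hj, rfl⟩))

theorem pre_lnb_cons_sub_sec_mem (hn : k < n) (i : Fin n) (c : Word n k) (hi : ∀ t, c t ≠ i) :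
    pre i (lnb (k + 1) (Fin.cons i c)) - sec R hn (eb c) ∈ Kspan R n k := by
  rw [sec_eb]
  have h1 := pre_lnb_cons_sub_mem (R := R) i i c hi hi
  have h2 := pre_lnb_cons_sub_mem (R := R) _ i c (exists_forall_ne hn c).choose_spec hi
  simpa using Submodule.sub_mem _ h1 h2

theorem cycRel_le_comap_sec (hn : k < n) : cycRel R n k ≤ (Kspan R n k).comap (sec R hn) := by
  refine Submodule.span_le.mpr ?_
  rintro _ ⟨w, rfl⟩
  obtain ⟨i, hi⟩ := exists_forall_ne hn w
  have hi' : ∀ t, (w ∘ finRotate k) t ≠ i := fun t => hi _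
  have h1 := pre_lnb_cons_sub_sec_mem (R := R) hn i w hi
  have h2 := pre_lnb_cons_sub_sec_mem (R := R) hn i _ hi'
  have h3 := pre_lnb_cons_sub_mem (R := R) i i _ hi' hi'
  rw [Function.comp_assoc, Equiv.self_comp_symm, Function.comp_id] at h3
  rw [SetLike.mem_coe, Submodule.mem_comap, map_sub]
  convert Submodule.sub_mem _ (Submodule.sub_mem _ h2 h1) h3 using 1
  abel

theorem DLie_le (hn : k + 2 ≤ n) :
    DLie R n k ≤ Kspan R n k ⊔ (sec R (show k < n by omega)).range := by
  refine Submodule.span_le.mpr ?_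
  rintro _ ⟨i, d, rfl⟩
  by_cases hi : ∀ t, d t ≠ i
  · exact Submodule.mem_sup_left (Submodule.subset_span (.inl (.inl (.inl ⟨i, d, hi, rfl⟩))))
  · push Not at hi
    obtain ⟨a, ha⟩ := exists_forall_ne (show k + 1 < n by omega) d
    have h4 : pre i (lnb (k + 1) d) - ∑ j : Fin (k + 1), (if d j = i then (1 : R) else 0) •
        pre a (lnb (k + 1) (Function.update d j a)) ∈ Kspan R n k :=
      Submodule.subset_span (.inr ⟨i, a, d, hi, ha, rfl⟩)
    rw [SetLike.mem_coe, ← sub_add_cancel (pre i (lnb (k + 1) d)) (∑ j : Fin (k + 1),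
      (if d j = i then (1 : R) else 0) • pre a (lnb (k + 1) (Function.update d j a)))]
    refine Submodule.add_mem _ (Submodule.mem_sup_left h4)
      (Submodule.sum_mem _ fun j _ => Submodule.smul_mem _ _ ?_)
    have h := lnb_mem_span_of_unique (R := R) a (Function.update d j a) j (by simp) fun t ht => by
      simpa [ht] using ha t
    have h' := Submodule.mem_map_of_mem (f := preL R (k + 1) a) h
    rw [Submodule.map_span] at h'
    refine Submodule.span_le.mpr ?_ h'
    rintro _ ⟨_, ⟨c, hc, rfl⟩, rfl⟩
    have h5 := pre_lnb_cons_sub_sec_mem (R := R) (show k < n by omega) a c hc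
    rw [SetLike.mem_coe, ← sub_add_cancel (preL R (k + 1) a (lnb (k + 1) (Fin.cons a c)))
      (sec R (show k < n by omega) (eb c))]
    exact Submodule.add_mem _ (Submodule.mem_sup_left h5) (Submodule.mem_sup_right ⟨_, rfl⟩)

end Kernel

end JC

open JC in
/-- Proposition T-Gen: for `k ≥ 2` and `n ≥ k+2`, the kernel of
`π_k ∘ Φ_{1,2} : H^* ⊗ L_n(k+1) → C_n(k)` (which is the image of the `k`-th Johnson
homomorphism `τ'_k` of `Aut F_n`) is generated as a `ℤ`-module by the elements of
types `K_1`, `K_2`, `K_3`, `K_4`. -/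
theorem ker_eq_span_K_generators (n k : ℕ) (hk : 2 ≤ k) (hn : k + 2 ≤ n)
    (x : TP ℤ n (k+2)) :
    x ∈ Submodule.span ℤ (K1set ℤ n k ∪ K2set ℤ n k ∪ K3set ℤ n k ∪ K4set ℤ n k) ↔
      (x ∈ DLie ℤ n k ∧ piC ℤ n k (Phi k 0 x) = 0) := by
  change x ∈ Kspan ℤ n k ↔ x ∈ DLie ℤ n k ∧ piC ℤ n k (PhiL ℤ n k x) = 0
  refine ⟨fun hx => ⟨Kspan_le_DLie hx, Kspan_le_ker hk hx⟩, fun ⟨hx, hx0⟩ => ?_⟩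
  obtain ⟨y, hy, _, ⟨z, rfl⟩, rfl⟩ := Submodule.mem_sup.mp (DLie_le hn hx)
  have hy0 : piC ℤ n k (PhiL ℤ n k y) = 0 := Kspan_le_ker hk hy
  rw [map_add, map_add, hy0, zero_add, PhiL_sec] at hx0
  have hz : z ∈ cycRel ℤ n k := (Submodule.Quotient.mk_eq_zero _).mp hx0
  exact Submodule.add_mem _ hy (cycRel_le_comap_sec _ hz)
end

section
/- Let k ≥ 1, let 1 ≤ ℓ ≤ k+1, and let i, i_1, …, i_k ∈ {1,…,n} with i ≠ i_1, i_2, …, i_k. Then Φ_{1,ℓ+1}(e_i^*⊗[e_i, e_{i_1}, …, e_{i_k}]) = (−1)^{ℓ−1} · Σ_S e_{←S}⊗e_{→S^c}, where the sum runs over all ordered subsets S of (i_1, i_2, …, i_k) with |S| = ℓ−1. -/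
open scoped TensorProduct

namespace JC

theorem swWord_apply_of_strictMono {N k p q : ℕ} (c : Word N k) (s : Finset (Fin k))
    (hp : s.card = p) (hq : sᶜ.card = q) (f : Fin p → Fin k) (hf : StrictMono f)
    (hfs : ∀ x, f x ∈ s) (g : Fin q → Fin k) (hg : StrictMono g) (hgs : ∀ x, g x ∈ sᶜ)
    (j : Fin k) :
    swWord c s j =
      if h : (j : ℕ) < p then c (f ⟨p - 1 - j, by omega⟩)
      else c (g ⟨j - p, by
        have h1 := Finset.card_compl s
        rw [Fintype.card_fin] at h1
        omega⟩) := by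
  subst hp hq
  have e1 := Finset.orderEmbOfFin_unique rfl hfs hf
  have e2 := Finset.orderEmbOfFin_unique rfl hgs hg
  subst e1 e2
  rfl

theorem card_add_card_compl_fin {k : ℕ} (s : Finset (Fin k)) : s.card + sᶜ.card = k := by
  simp

theorem strictMono_castSucc_orderEmbOfFin {k : ℕ} (s : Finset (Fin k)) :
    StrictMono (fun x => (s.orderEmbOfFin rfl x).castSucc) := fun a b h => by
  simpa using h

theorem strictMono_snoc_castSucc_orderEmbOfFin {k : ℕ} (s : Finset (Fin k)) :
    StrictMono (Fin.snoc (fun x => (s.orderEmbOfFin rfl x).castSucc) (Fin.last k) :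
      Fin (s.card + 1) → Fin (k + 1)) := fun a b h => by
  induction a using Fin.lastCases with
  | last => exact absurd h (not_lt.2 (Fin.le_last b))
  | cast a =>
    induction b using Fin.lastCases with
    | last => simp [Fin.castSucc_lt_last]
    | cast b => simpa using h

theorem compl_map_castSucc {k : ℕ} (s : Finset (Fin k)) :
    (s.map Fin.castSuccEmb)ᶜ = insert (Fin.last k) (sᶜ.map Fin.castSuccEmb) := by
  ext a
  induction a using Fin.lastCases <;> simp

theorem compl_insert_last_map_castSucc {k : ℕ} (s : Finset (Fin k)) :
    (insert (Fin.last k) (s.map Fin.castSuccEmb))ᶜ = sᶜ.map Fin.castSuccEmb := by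
  ext a
  induction a using Fin.lastCases <;> simp

theorem card_insert_last_map_castSucc {k : ℕ} (s : Finset (Fin k)) :
    (insert (Fin.last k) (s.map Fin.castSuccEmb)).card = s.card + 1 := by
  rw [Finset.card_insert_of_notMem (by simp), Finset.card_map]

theorem snoc_castSucc_orderEmbOfFin_mem {k : ℕ} (s : Finset (Fin k)) (x : Fin (s.card + 1)) :
    (Fin.snoc (fun x => (s.orderEmbOfFin rfl x).castSucc) (Fin.last k) :
      Fin (s.card + 1) → Fin (k + 1)) x ∈ insert (Fin.last k) (s.map Fin.castSuccEmb) := by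
  induction x using Fin.lastCases <;> simp

theorem swWord_map_castSucc {N k : ℕ} (c : Word N (k + 1)) (s : Finset (Fin k)) :
    swWord c (s.map Fin.castSuccEmb) = Fin.snoc (swWord (Fin.init c) s) (c (Fin.last k)) := by
  funext j
  have hk := card_add_card_compl_fin s
  rw [swWord_apply_of_strictMono c _ (Finset.card_map _)
    (by rw [compl_map_castSucc, card_insert_last_map_castSucc])
    _ (strictMono_castSucc_orderEmbOfFin s) (fun x => by simp)
    _ (strictMono_snoc_castSucc_orderEmbOfFin sᶜ)
    (fun x => by rw [compl_map_castSucc]; exact snoc_castSucc_orderEmbOfFin_mem _ x)]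
  induction j using Fin.lastCases with
  | last =>
    rw [dif_neg (by simp; omega), Fin.snoc_last]
    congr 1
    convert Fin.snoc_last (α := fun _ => Fin (k + 1)) _ _ using 2
    ext
    simp
    omega
  | cast j =>
    rw [Fin.snoc_castSucc]
    unfold swWord Fin.init
    simp only [Fin.val_castSucc]
    split_ifs with h
    · rfl
    · congr 1
      have hj := j.isLt
      exact Fin.snoc_castSucc (α := fun _ => Fin (k + 1)) _ _ ⟨j - s.card, by omega⟩

theorem swWord_insert_last_map_castSucc {N k : ℕ} (c : Word N (k + 1)) (s : Finset (Fin k)) :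
    swWord c (insert (Fin.last k) (s.map Fin.castSuccEmb)) =
      Fin.cons (c (Fin.last k)) (swWord (Fin.init c) s) := by
  funext j
  have hk := card_add_card_compl_fin s
  rw [swWord_apply_of_strictMono c _ (card_insert_last_map_castSucc s)
    (by rw [compl_insert_last_map_castSucc, Finset.card_map])
    _ (strictMono_snoc_castSucc_orderEmbOfFin s) (snoc_castSucc_orderEmbOfFin_mem s)
    _ (strictMono_castSucc_orderEmbOfFin sᶜ)
    (fun x => by
      rw [compl_insert_last_map_castSucc]
      exact Finset.mem_map_of_mem Fin.castSuccEmb (Finset.orderEmbOfFin_mem _ rfl x))]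
  induction j using Fin.cases with
  | zero =>
    rw [dif_pos (by simp), Fin.cons_zero]
    congr 1
    exact Fin.snoc_last (α := fun _ => Fin (k + 1)) _ _
  | succ j =>
    rw [Fin.cons_succ]
    unfold swWord Fin.init
    simp only [Fin.val_succ, Nat.add_lt_add_iff_right]
    split_ifs with h
    · congr 1
      refine (congrArg _ (Fin.ext ?_)).trans (Fin.snoc_castSucc (α := fun _ => Fin (k + 1)) _ _
        (⟨s.card - 1 - j, by omega⟩ : Fin s.card))
      simp only [Fin.castSucc_mk]
      omega
    · exact congrArg (fun x => c (Fin.castSucc (sᶜ.orderEmbOfFin rfl x))) (Fin.ext (by simp))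

theorem sum_finset_fin_succ {M : Type*} [AddCommMonoid M] {k : ℕ}
    (f : Finset (Fin (k + 1)) → M) :
    ∑ s, f s = ∑ s : Finset (Fin k), f (s.map Fin.castSuccEmb) +
      ∑ s : Finset (Fin k), f (insert (Fin.last k) (s.map Fin.castSuccEmb)) := by
  have hu : (Finset.univ : Finset (Fin (k + 1))) =
      insert (Fin.last k) (Finset.univ.map Fin.castSuccEmb) := by
    ext a
    induction a using Fin.lastCases <;> simp
  have hm (g : Finset (Fin (k + 1)) → M) :
      ∑ t ∈ (Finset.univ.map (Fin.castSuccEmb (n := k))).powerset, g t =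
        ∑ s : Finset (Fin k), g (s.map Fin.castSuccEmb) := by
    symm
    refine Finset.sum_bij (fun s _ => s.map Fin.castSuccEmb) ?_ ?_ ?_ ?_
    · intro s _
      exact Finset.mem_powerset.2 (Finset.map_subset_map.2 (Finset.subset_univ s))
    · intro s _ t _ h
      exact Finset.map_injective _ h
    · intro t ht
      obtain ⟨s, -, rfl⟩ := Finset.subset_map_iff.1 (Finset.mem_powerset.1 ht)
      exact ⟨s, Finset.mem_univ s, rfl⟩
    · intro s _
      rfl
  rw [← Finset.powerset_univ, hu, Finset.sum_powerset_insert (by simp), hm, hm]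

theorem lnb_cons_insertNth {R : Type} [CommRing R] {N k : ℕ} (i : Fin N) (c : Word N k)
    (hc : ∀ t, c t ≠ i) (ℓ : Fin (k + 1)) (u : Word N k) :
    (lnb (k + 1) (Fin.cons i c) : TP R N (k + 1)) (Fin.insertNth ℓ i u) =
      (-1) ^ (ℓ : ℕ) *
        ∑ s : Finset (Fin k), if s.card = (ℓ : ℕ) then eb (swWord c s) u else 0 := by
  induction k with
  | zero =>
    have e : Fin.insertNth ℓ i u = (Fin.cons i c : Word N 1) := by
      funext j
      obtain rfl : j = ℓ := by omega
      obtain rfl : j = 0 := by omega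
      simp
    rw [e, Fintype.sum_subsingleton _ (∅ : Finset (Fin 0)), Subsingleton.elim u (swWord c ∅)]
    simp [lnb, eb]
  | succ k ih =>
    have hinit : Fin.init (Fin.cons i c : Word N (k + 2)) = Fin.cons i (Fin.init c) := by
      funext j
      induction j using Fin.cases <;> rfl
    have hlast : (Fin.cons i c : Word N (k + 2)) (Fin.last (k + 1)) = c (Fin.last k) := rfl
    have ih' := ih (Fin.init c) (fun t => hc t.castSucc)
    rw [sum_finset_fin_succ, mul_add, lnb, brkt, hinit, hlast, sub_eq_add_neg]
    simp only [Finset.card_map, card_insert_last_map_castSucc, swWord_map_castSucc,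
      swWord_insert_last_map_castSucc]
    congr 1
    · induction ℓ using Fin.lastCases with
      | last =>
        rw [Fin.insertNth_apply_same, if_neg (hc _).symm, Finset.sum_eq_zero, mul_zero]
        intro s _
        have := card_add_card_compl_fin s
        rw [if_neg (by simp; omega)]
      | cast ℓ =>
        have h1 : (Fin.insertNth ℓ.castSucc i u : Word N (k + 2)) (Fin.last (k + 1)) =
            u (Fin.last k) := by
          simpa using Fin.insertNth_apply_succAbove (α := fun _ => Fin N) ℓ.castSucc i u (Fin.last k)
        have h2 : Fin.init (Fin.insertNth ℓ.castSucc i u : Word N (k + 2)) =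
            Fin.insertNth ℓ i (Fin.init u) := by
          funext j
          induction j using Fin.succAboveCases ℓ with
          | x => simp [Fin.init]
          | p j =>
            rw [Fin.insertNth_apply_succAbove, Fin.init, ← Fin.castSucc_succAbove_castSucc,
              Fin.insertNth_apply_succAbove, Fin.init]
        have h3 (s : Finset (Fin k)) :
            (eb (Fin.snoc (swWord (Fin.init c) s) (c (Fin.last k)) : Word N (k + 1)) :
              TP R N (k + 1)) u =
            if u (Fin.last k) = c (Fin.last k) then eb (swWord (Fin.init c) s) (Fin.init u)
            else 0 := by
          induction u using Fin.snocCases with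
          | snoc u x => simp [eb, Fin.snoc_inj, ← ite_and, and_comm]
        rw [h1, h2, ih']
        simp only [h3, Fin.val_castSucc]
        split_ifs <;> simp
    · induction ℓ using Fin.cases with
      | zero =>
        rw [Fin.insertNth_apply_same, if_neg (hc _).symm, Finset.sum_eq_zero] <;> simp
      | succ ℓ =>
        have h1 : (Fin.insertNth ℓ.succ i u : Word N (k + 2)) 0 = u 0 := by
          simpa using Fin.insertNth_apply_succAbove (α := fun _ => Fin N) ℓ.succ i u 0
        have h2 : Fin.tail (Fin.insertNth ℓ.succ i u : Word N (k + 2)) =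
            Fin.insertNth ℓ i (Fin.tail u) := by
          funext j
          induction j using Fin.succAboveCases ℓ with
          | x => simp [Fin.tail]
          | p j =>
            rw [Fin.insertNth_apply_succAbove, Fin.tail, ← Fin.succ_succAbove_succ,
              Fin.insertNth_apply_succAbove, Fin.tail]
        have h3 (s : Finset (Fin k)) :
            (eb (Fin.cons (c (Fin.last k)) (swWord (Fin.init c) s) : Word N (k + 1)) :
              TP R N (k + 1)) u =
            if u 0 = c (Fin.last k) then eb (swWord (Fin.init c) s) (Fin.tail u)
            else 0 := by
          induction u using Fin.consCases with
          | cons x u => simp [eb, Fin.cons_inj, ← ite_and]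
        rw [h1, h2, ih']
        simp only [h3, Fin.val_succ, Nat.add_right_cancel_iff]
        split_ifs <;> simp [pow_succ]

end JC

open JC in
/-- Lemma L-HKT: for `k ≥ 1`, `1 ≤ ℓ ≤ k+1` (here `ℓ : Fin (k+1)` is
0-based, equal to the paper's `ℓ - 1`) and indices `i, i_1, …, i_k` with `i ≠ i_1, …, i_k`,
`Φ_{1,ℓ+1}(e_i^* ⊗ [e_i, e_{i_1}, …, e_{i_k}]) = (-1)^{ℓ-1} Σ_{|S|=ℓ-1} e_{←S} ⊗ e_{→S^c}`,
the sum being over all ordered subsets `S` of `(i_1, …, i_k)` with `|S| = ℓ-1`. -/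
theorem Phi_of_K3_generator (n k : ℕ) (hk : 1 ≤ k) (i : Fin n) (c : Word n k)
    (hc : ∀ t, c t ≠ i) (ℓ : Fin (k+1)) :
    Phi k ℓ (pre i (lnb (k+1) (Fin.cons i c)) : TP ℤ n (k+2)) =
      ((-1 : ℤ) ^ (ℓ:ℕ)) •
        ∑ s ∈ Finset.univ.filter (fun s : Finset (Fin k) => s.card = (ℓ:ℕ)),
          eb (swWord c s) := by
  funext u
  simp only [Phi, pre, Fin.cons_zero, Fin.tail_cons, Finset.sum_ite_eq', Finset.mem_univ, if_true,
    Finset.sum_filter, Pi.smul_apply, smul_eq_mul, Finset.sum_apply, ite_apply, Pi.zero_apply]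
  exact lnb_cons_insertNth i c hc ℓ u
end

section
/- Let k ≥ 1 and let i, m, i_1, …, i_{k+1} ∈ {1,…,n} with m ∉ {i_1,…,i_{k+1}}. Then for every 1 ≤ ℓ ≤ k+1, Φ_{1,ℓ+1}( e_i^*⊗[e_{i_1}, e_{i_2}, …, e_{i_{k+1}}] ) = Σ_{j=1}^{k+1} δ_{i,i_j} · Φ_{1,ℓ+1}( e_m^*⊗[e_{i_1}, …, e_{i_{j−1}}, e_m, e_{i_{j+1}}, …, e_{i_{k+1}}] ) in H^{⊗(k+1)}. In particular, every generator of type K4 lies in the kernel of Φ_{1,ℓ+1} for every ℓ. -/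
open scoped TensorProduct

namespace JC

/-- A left-normed bracket of basis vectors is a signed sum of words obtained by permuting its
letters, with signs and permutations independent of the letters. -/
theorem exists_lnb_eq_sum_eb (R : Type) [CommRing R] (N m : ℕ) :
    ∃ (ι : Type) (_ : Fintype ι) (s : ι → R) (σ : ι → Fin (m+1) → Fin (m+1)),
      (∀ a, Function.Injective (σ a)) ∧
      ∀ d w : Word N (m+1), lnb (R := R) (m+1) d w = ∑ a, s a * eb (d ∘ σ a) w := by
  induction m with
  | zero =>
    exact ⟨Unit, inferInstance, fun _ => 1, fun _ => id, fun _ => Function.injective_id,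
      fun d w => by simp [lnb]⟩
  | succ m ih =>
    obtain ⟨ι, hι, s, σ, hσ, h⟩ := ih
    refine ⟨ι ⊕ ι, inferInstance, Sum.elim s (fun a => -s a),
      Sum.elim (fun a => Fin.snoc (fun t => (σ a t).castSucc) (Fin.last (m+1)))
        (fun a => Fin.cons (Fin.last (m+1)) (fun t => (σ a t).castSucc)), ?_, ?_⟩
    · rintro (a | a)
      · exact Fin.snoc_injective_iff.2
          ⟨(Fin.castSucc_injective _).comp (hσ a), by simp⟩
      · exact Fin.cons_injective_iff.2
          ⟨by simp, (Fin.castSucc_injective _).comp (hσ a)⟩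
    · intro d w
      have hsnoc (a : ι) :
          (w = d ∘ Fin.snoc (α := fun _ => Fin (m+2))
              (fun t => (σ a t).castSucc) (Fin.last (m+1))) ↔
            w (Fin.last (m+1)) = d (Fin.last (m+1)) ∧ Fin.init w = Fin.init d ∘ σ a := by
        simp [funext_iff, Fin.forall_fin_succ', Fin.init, and_comm]
      have hcons (a : ι) :
          (w = d ∘ Fin.cons (α := fun _ => Fin (m+2))
              (Fin.last (m+1)) (fun t => (σ a t).castSucc)) ↔
            w 0 = d (Fin.last (m+1)) ∧ Fin.tail w = Fin.init d ∘ σ a := by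
        simp [funext_iff, Fin.forall_fin_succ, Fin.init, Fin.tail]
      simp only [lnb, brkt, h, eb, Fintype.sum_sum_type, Sum.elim_inl, Sum.elim_inr, hsnoc, hcons,
        ite_and]
      split_ifs <;> simp [sub_eq_add_neg, -mul_ite]

/-- Marking with a fresh letter `b` a position of the word, and summing over the matching entries
of the bracket, does not change the coefficient of the word in the bracket. -/
theorem lnb_insertNth_eq_sum_update {R : Type} [CommRing R] {N k : ℕ} (d : Word N (k+1))
    {b : Fin N} (hb : ∀ t, d t ≠ b) (i : Fin N) (p : Fin (k+1)) (u : Word N k) :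
    lnb (R := R) (k+1) d (p.insertNth i u) =
      ∑ j, (if d j = i then (1 : R) else 0) *
        lnb (k+1) (Function.update d j b) (p.insertNth b u) := by
  obtain ⟨ι, _, s, σ, hσ, h⟩ := exists_lnb_eq_sum_eb R N k
  simp only [h, Finset.mul_sum]
  rw [Finset.sum_comm]
  refine Finset.sum_congr rfl fun a _ => ?_
  rw [Finset.sum_eq_single (σ a p)]
  · have hd : ∀ t, Function.update d (σ a p) b (σ a (p.succAbove t)) =
        d (σ a (p.succAbove t)) := fun t =>
      Function.update_of_ne ((hσ a).ne (Fin.succAbove_ne p t)) _ _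
    simp only [eb, funext_iff, Fin.forall_iff_succAbove p, Fin.insertNth_apply_same,
      Fin.insertNth_apply_succAbove, Function.comp_apply, Function.update_self, hd, true_and,
      ite_and, eq_comm (a := i)]
    split_ifs <;> simp
  · intro j _ hj
    have hne : (p.insertNth b u : Word N (k+1)) ≠ Function.update d j b ∘ σ a := fun e => by
      have := congrFun e p
      rw [Fin.insertNth_apply_same, Function.comp_apply, Function.update_of_ne hj.symm] at this
      exact hb _ this.symm
    simp [eb, hne]
  · simp

theorem Phi_pre_apply {R : Type} [CommRing R] {N k : ℕ} (ℓ : Fin (k+1)) (i : Fin N)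
    (x : TP R N (k+1)) (u : Word N k) : Phi k ℓ (pre i x) u = x (ℓ.insertNth i u) := by
  simp [Phi, pre]

/-- The contraction `Phi` as a linear map. -/
def PhiLin (R : Type) [CommRing R] (N k : ℕ) (ℓ : Fin (k+1)) : TP R N (k+2) →ₗ[R] TP R N k where
  toFun := Phi k ℓ
  map_add' x y := by ext u; simp [Phi, Finset.sum_add_distrib]
  map_smul' c x := by ext u; simp [Phi, Finset.mul_sum]

end JC

open JC in
/-- for `k ≥ 1`, indices `i, m, i_1, …, i_{k+1}` with `m ∉ {i_1,…,i_{k+1}}`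
and every `1 ≤ ℓ ≤ k+1` (here `ℓ : Fin (k+1)` is 0-based),
`Φ_{1,ℓ+1}(e_i^* ⊗ [e_{i_1}, …, e_{i_{k+1}}]) = Σ_j δ_{i,i_j} Φ_{1,ℓ+1}(e_m^* ⊗ [e_{i_1}, …, e_m, …, e_{i_{k+1}}])`;
in particular the type `K_4` generators lie in the kernel of every `Φ_{1,ℓ+1}`. -/
theorem Phi_of_K4_generator (n k : ℕ) (hk : 1 ≤ k) (i m' : Fin n) (d : Word n (k+1))
    (hm : ∀ t, d t ≠ m') (ℓ : Fin (k+1)) :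
    (Phi k ℓ (pre i (lnb (k+1) d) : TP ℤ n (k+2)) =
      ∑ j : Fin (k+1),
        (if d j = i then (1:ℤ) else 0) •
          Phi k ℓ (pre m' (lnb (k+1) (Function.update d j m'))))
    ∧ Phi k ℓ
        ((pre i (lnb (k+1) d) : TP ℤ n (k+2))
          - ∑ j : Fin (k+1),
              (if d j = i then (1:ℤ) else 0) •
                pre m' (lnb (k+1) (Function.update d j m'))) = 0 := by
  have key : Phi k ℓ (pre i (lnb (k+1) d) : TP ℤ n (k+2)) =
      ∑ j : Fin (k+1), (if d j = i then (1:ℤ) else 0) •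
        Phi k ℓ (pre m' (lnb (k+1) (Function.update d j m'))) := by
    ext u
    simp only [Finset.sum_apply, Pi.smul_apply, smul_eq_mul, Phi_pre_apply]
    exact lnb_insertNth_eq_sum_update d hm i ℓ u
  refine ⟨key, ?_⟩
  change PhiLin ℤ n k ℓ _ = 0
  rw [map_sub, map_sum, sub_eq_zero]
  simp only [map_smul]
  exact key
end

section
/- Suppose k ≥ 2 and n ≥ k+2. Then the homomorphism π_k∘Φ_{1,2} : H^*⊗L_n(k+1) → C_n(k) is surjective. -/
open scoped TensorProduct

namespace JC

section
variable {R : Type} [CommRing R] {N : ℕ}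

/-- If the letter `i` does not occur in `c`, the only word starting with `i` that occurs in
`[e_i, e_{c 0}, …, e_{c (m-1)}]` is `i c`, with coefficient `1`. -/
lemma lnb_cons_apply_cons {i : Fin N} : ∀ {m : ℕ} (c w : Word N m), (∀ t, c t ≠ i) →
    lnb (R := R) (m + 1) (Fin.cons i c : Word N (m + 1)) (Fin.cons i w : Word N (m + 1))
      = eb c w
  | 0, c, w, _ => by
    have h : w = c := Subsingleton.elim _ _
    subst h
    simp [lnb, eb]
  | m + 1, c, w, hc => by
    have hinit (v : Word N (m + 1)) : (Fin.init (Fin.cons i v : Word N (m + 2)) : Word N (m + 1))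
        = (Fin.cons i (Fin.init v) : Word N (m + 1)) := by
      funext t
      refine Fin.cases rfl (fun s => rfl) t
    have hlast (v : Word N (m + 1)) :
        (Fin.cons i v : Word N (m + 2)) (Fin.last (m + 1)) = v (Fin.last m) := rfl
    have ih := lnb_cons_apply_cons (Fin.init c) (Fin.init w) (fun t => hc t.castSucc)
    have hw : w = c ↔ w (Fin.last m) = c (Fin.last m) ∧
        (Fin.init w : Word N m) = Fin.init c := by
      constructor
      · rintro rfl
        exact ⟨rfl, rfl⟩
      · rintro ⟨h1, h2⟩
        rw [← Fin.snoc_init_self w, ← Fin.snoc_init_self c, h1, h2]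
    change brkt (lnb (m + 1) (Fin.init (Fin.cons i c : Word N (m + 2)) : Word N (m + 1)))
      ((Fin.cons i c : Word N (m + 2)) (Fin.last (m + 1))) (Fin.cons i w : Word N (m + 2)) = _
    simp only [brkt, hlast, hinit, ih, Fin.cons_zero, if_neg (hc (Fin.last m)).symm, sub_zero,
      eb, hw, ite_and]

/-- The contraction of `e_i^* ⊗ [e_i, e_{c 0}, …, e_{c (k-1)}]` is the word `c` itself when
`i` does not occur in `c`. -/
lemma Phi_zero_pre_lnb_cons {k : ℕ} {i : Fin N} (c : Word N k) (hc : ∀ t, c t ≠ i) :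
    Phi (R := R) k 0 (pre i (lnb (k + 1) (Fin.cons i c : Word N (k + 1)))) = eb c := by
  funext u
  simp only [Phi, pre, Fin.cons_zero, Fin.tail_cons, Fin.insertNth_zero',
    Finset.sum_ite_eq', Finset.mem_univ, if_true]
  exact lnb_cons_apply_cons c u hc

lemma Phi_sum_smul {ι : Type*} [Fintype ι] {k : ℕ} (ℓ : Fin (k + 1)) (a : ι → R)
    (f : ι → TP R N (k + 2)) :
    Phi k ℓ (∑ t, a t • f t) = ∑ t, a t • Phi k ℓ (f t) := by
  funext u
  simp only [Phi, Finset.sum_apply, Pi.smul_apply, smul_eq_mul, Finset.mul_sum]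
  exact Finset.sum_comm

lemma sum_smul_eb {m : ℕ} (x : TP R N m) : ∑ w, x w • eb w = x := by
  funext u
  simp [eb, Finset.sum_apply]

/-- The contraction `Φ_{1,2}` maps `H^* ⊗ L_N(k+1)` onto `H^{⊗k}` as soon as `k < N`. -/
lemma exists_mem_DLie_Phi_zero_eq {k : ℕ} (hk : k < N) (z : TP R N k) :
    ∃ x ∈ DLie R N k, Phi k 0 x = z := by
  have fresh (c : Word N k) : ∃ i, ∀ t, c t ≠ i := by
    by_contra! h
    have := Fintype.card_le_of_surjective c h
    simp only [Fintype.card_fin] at this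
    omega
  choose i hi using fresh
  refine ⟨∑ c, z c • pre (i c) (lnb (k + 1) (Fin.cons (i c) c : Word N (k + 1))),
    Submodule.sum_mem _ fun c _ => Submodule.smul_mem _ _ (Submodule.subset_span ⟨_, _, rfl⟩), ?_⟩
  simp only [Phi_sum_smul, Phi_zero_pre_lnb_cons _ (hi _), sum_smul_eb]

end

end JC

open JC in
/-- Theorem thm-Satoh (i): for `k ≥ 2` and `n ≥ k+2`, the homomorphism
`π_k ∘ Φ_{1,2} : H^* ⊗ L_n(k+1) → C_n(k)` is surjective. -/
theorem piC_comp_Phi_surjective (n k : ℕ) (hk : 2 ≤ k) (hn : k + 2 ≤ n) :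
    ∀ y : Cyc ℤ n k, ∃ x ∈ DLie ℤ n k, piC ℤ n k (Phi k 0 x) = y := by
  intro y
  obtain ⟨z, rfl⟩ := (cycRel ℤ n k).mkQ_surjective y
  obtain ⟨x, hx, rfl⟩ := exists_mem_DLie_Phi_zero_eq (by omega : k < n) z
  exact ⟨x, hx, rfl⟩
end
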